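/- Let m ≥ 2 be an integer and let c : ℤ^4 → ℤ be the function determined by: c(n,t,i,j) = 0 whenever any of n, t, i, j is negative; c(n,0,i,j) = 1 if n ≥ 0 and i = j = 0, and c(n,0,i,j) = 0 otherwise; and for all n, t, i, j ≥ 0, c(n,t+1,i,j) = c(n,t,i,j) + c(n-1,t+1,i,j) + c(n-1,t,i-1,j) + c(n-m-1,t+1,i-1,j-m+1) + c(n-m-1,t+1,i-2,j-m+1). Then for all n, i, j ≥ 0 and t ≥ 1: c(n,t,i,j) = 0 unless j = (m-1)ℓ for some integer ℓ with 0 ≤ ℓ ≤ i, and for every integer ℓ ≥ 0 one has c(n,t,i,(m-1)ℓ) = d(n,t,i,ℓ). -/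

import Mathlib

/-- The binomial coefficient `C(a,b)` for integers `a, b`, with the convention
that `C(a,b) = 0` if `a < 0`, `b < 0`, or `a < b`. -/
def intChoose (a b : ℤ) : ℤ :=
  if a < 0 ∨ b < 0 ∨ a < b then 0 else (Nat.choose a.toNat b.toNat : ℤ)

/-- `d(n,t,i,ℓ) = C(t+ℓ-1, ℓ) · C(n-ℓm, i-ℓ) · C(n+t-ℓm-i+ℓ, t-i+2ℓ)`. -/
def dFun (m n t i l : ℤ) : ℤ :=
  intChoose (t + l - 1) l * intChoose (n - l * m) (i - l) *
    intChoose (n + t - l * m - i + l) (t - i + 2 * l)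


lemma ic_zero {a b : ℤ} (h : a < 0 ∨ b < 0 ∨ a < b) : intChoose a b = 0 := by
  unfold intChoose; rw [if_pos h]

lemma ic_nat (a b : ℕ) : intChoose a b = Nat.choose a b := by
  unfold intChoose
  split_ifs with h
  · rw [Nat.choose_eq_zero_of_lt (by omega)]; rfl
  · simp

lemma ic_pascal (a b : ℤ) (h : ¬ (a = 0 ∧ b = 0)) :
    intChoose a b = intChoose (a - 1) b + intChoose (a - 1) (b - 1) := by
  by_cases ha : a ≤ 0
  · rw [ic_zero (by omega), ic_zero (by omega), ic_zero (by omega)]; rfl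
  by_cases hb : b < 0
  · rw [ic_zero (by omega), ic_zero (by omega), ic_zero (by omega)]; rfl
  obtain ⟨x, rfl⟩ : ∃ x : ℕ, a = (x : ℤ) + 1 := ⟨(a - 1).toNat, by omega⟩
  obtain ⟨y, rfl⟩ : ∃ y : ℕ, b = (y : ℤ) := ⟨b.toNat, by omega⟩
  rw [add_sub_cancel_right]
  rcases y with _ | y
  · rw [ic_zero (b := ((0 : ℕ) : ℤ) - 1) (by simp)]
    have := ic_nat (x + 1) 0
    push_cast at this
    have h2 := ic_nat x 0
    push_cast at h2
    simp [this, h2]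
  · have h1 := ic_nat (x + 1) (y + 1)
    have h2 := ic_nat x (y + 1)
    have h3 := ic_nat x y
    rw [Nat.choose_succ_succ] at h1
    push_cast at *
    rw [add_sub_cancel_right, h1, h2, h3]; ring

lemma ic_self (a : ℤ) (h : 0 ≤ a) : intChoose a a = 1 := by
  lift a to ℕ using h
  rw [ic_nat]; simp

lemma ic_right0 (a : ℤ) (h : 0 ≤ a) : intChoose a 0 = 1 := by
  lift a to ℕ using h
  have := ic_nat a 0
  simpa using this

/-- first factor, corrected at t = l = 0 -/
def aFac (t l : ℤ) : ℤ := if l = 0 then 1 else intChoose (t + l - 1) l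

lemma aFac_rec (t l : ℤ) (ht : 0 ≤ t) : aFac (t + 1) l = aFac t l + aFac (t + 1) (l - 1) := by
  unfold aFac
  by_cases h : l = 0
  · subst h; rw [if_pos rfl, if_pos rfl, if_neg (by omega), ic_zero (by omega)]; rfl
  rw [if_neg h, if_neg h]
  have e := ic_pascal (t + 1 + l - 1) l (by omega)
  rw [e, show t + 1 + l - 1 - 1 = t + l - 1 by ring]
  congr 1
  split_ifs with h1
  · rw [h1, ic_right0 _ (by omega)]
  · congr 1; ring

/-- corrected closed form -/
def eFun (N t k l : ℤ) : ℤ := aFac t l * intChoose N k * intChoose (N + t - k) (t - k + l)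

lemma aFac_neg (t l : ℤ) (h : l < 0) : aFac t l = 0 := by
  unfold aFac; rw [if_neg (by omega), ic_zero (by omega)]

lemma eFun_rec (N t k l : ℤ) (ht : 0 ≤ t) (hl : 0 ≤ l) :
    eFun N (t + 1) k l = eFun N t k l + eFun (N - 1) (t + 1) k l + eFun (N - 1) t (k - 1) l
      + eFun (N - 1) (t + 1) k (l - 1) + eFun (N - 1) (t + 1) (k - 1) (l - 1) := by
  unfold eFun
  rw [show N - 1 + (t + 1) - k = N + t - k by ring, show N - 1 + t - (k - 1) = N + t - k by ring,
    show t - (k - 1) + l = t + 1 - k + l by ring, show t + 1 - k + (l - 1) = t - k + l by ring,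
    show N - 1 + (t + 1) - (k - 1) = N + (t + 1) - k by ring,
    show t + 1 - (k - 1) + (l - 1) = t + 1 - k + l by ring]
  by_cases h0 : N < k ∨ N < 0
  · rw [ic_zero (a := N) (b := k) (by omega), ic_zero (a := N - 1) (b := k) (by omega),
      ic_zero (a := N - 1) (b := k - 1) (by omega)]; ring
  by_cases h1 : N = 0 ∧ k = 0
  · obtain ⟨rfl, rfl⟩ := h1
    rw [ic_zero (a := 0 - 1) (b := 0) (by omega), ic_zero (a := 0 - 1) (b := 0 - 1) (by omega)]
    by_cases h2 : l = 0
    · subst h2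
      simp only [aFac, zero_add, sub_zero, add_zero, if_true]
      rw [ic_self t ht, ic_self (t + 1) (by omega), ic_right0 0 (by omega)]; ring
    · rw [ic_zero (a := 0 + (t + 1) - 0) (by omega), ic_zero (a := 0 + t - 0) (b := t - 0 + l) (by omega)]
      ring
  rw [ic_pascal N k h1, ic_pascal (N + (t + 1) - k) (t + 1 - k + l) (by omega),
    show N + (t + 1) - k - 1 = N + t - k by ring, show t + 1 - k + l - 1 = t - k + l by ring,
    aFac_rec t l ht]
  ring

lemma eFun_zero (N t k l : ℤ) (h : N < 0 ∨ k < 0 ∨ l < 0) : eFun N t k l = 0 := by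
  unfold eFun
  by_cases hl : l < 0
  · rw [aFac_neg _ _ hl]; ring
  · rw [ic_zero (a := N) (by omega)]; ring

lemma eFun_t0 (n m i l : ℤ) :
    eFun (n - l * m) 0 (i - l) l = if 0 ≤ n ∧ i = 0 ∧ l = 0 then 1 else 0 := by
  by_cases hl : l = 0
  · subst hl
    unfold eFun
    by_cases hi : i = 0
    · subst hi
      by_cases hn : 0 ≤ n
      · simp [aFac, hn, ic_right0]
      · rw [ic_zero (a := n - 0 * m) (by left; linarith)]; simp [hn]
    · simp only [hi, false_and, and_false, if_false]
      by_cases h : i < 0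
      · rw [ic_zero (b := i - 0) (by omega)]; ring
      · rw [ic_zero (b := 0 - (i - 0) + 0) (by omega)]; ring
  · simp only [hl, and_false, if_false]
    unfold eFun aFac
    rw [if_neg hl, ic_zero (b := l) (by omega)]; ring

lemma key (m : ℤ) (hm : 2 ≤ m) (c : ℤ → ℤ → ℤ → ℤ → ℤ)
    (hneg : ∀ n t i j : ℤ, n < 0 ∨ t < 0 ∨ i < 0 ∨ j < 0 → c n t i j = 0)
    (hzero : ∀ n i j : ℤ,
      c n 0 i j = if 0 ≤ n ∧ i = 0 ∧ j = 0 then 1 else 0)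
    (hrec : ∀ n t i j : ℤ, 0 ≤ n → 0 ≤ t → 0 ≤ i → 0 ≤ j →
      c n (t + 1) i j =
        c n t i j + c (n - 1) (t + 1) i j + c (n - 1) t (i - 1) j
          + c (n - m - 1) (t + 1) (i - 1) (j - m + 1)
          + c (n - m - 1) (t + 1) (i - 2) (j - m + 1)) (K : ℕ) :
    ∀ n : ℤ, n < K → ∀ (t : ℕ) (i : ℤ),
      (∀ l : ℤ, c n t i ((m - 1) * l) = eFun (n - l * m) t (i - l) l) ∧
      (∀ j : ℤ, ¬ (m - 1) ∣ j → c n t i j = 0) := by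
  have hbad : ∀ n t i l : ℤ, n < 0 ∨ i < 0 ∨ l < 0 →
      c n t i ((m - 1) * l) = 0 ∧ eFun (n - l * m) t (i - l) l = 0 := by
    intro n t i l h
    by_cases hl : l < 0
    · exact ⟨hneg _ _ _ _ (by right; right; right; nlinarith), eFun_zero _ _ _ _ (by omega)⟩
    · refine ⟨hneg _ _ _ _ (by omega), eFun_zero _ _ _ _ ?_⟩
      rcases h with h | h | h
      · left; nlinarith
      · omega
      · omega
  induction K with
  | zero =>
    intro n hn t i
    push_cast at hn
    refine ⟨fun l => ?_, fun j _ => hneg _ _ _ _ (by omega)⟩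
    obtain ⟨h1, h2⟩ := hbad n t i l (by omega)
    rw [h1, h2]
  | succ K ih =>
    intro n hn t
    push_cast at hn
    induction t with
    | zero =>
      intro i
      refine ⟨fun l => ?_, fun j hj => ?_⟩
      · push_cast
        rw [hzero, eFun_t0]
        have : (m - 1) * l = 0 ↔ l = 0 := by
          rw [mul_eq_zero]; constructor
          · rintro (h | h) <;> omega
          · exact Or.inr
        simp only [this]
      · push_cast
        rw [hzero, if_neg]
        rintro ⟨_, _, rfl⟩
        exact hj (dvd_zero _)
    | succ t iht =>
      intro i
      refine ⟨fun l => ?_, fun j hj => ?_⟩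
      · by_cases hb : n < 0 ∨ i < 0 ∨ l < 0
        · obtain ⟨h1, h2⟩ := hbad n ((t + 1 : ℕ) : ℤ) i l hb
          rw [h1, h2]
        · have hj : 0 ≤ (m - 1) * l := mul_nonneg (by omega) (by omega)
          have e1 := (iht i).1 l
          have e2 := (ih (n - 1) (by omega) (t + 1) i).1 l
          have e3 := (ih (n - 1) (by omega) t (i - 1)).1 l
          have e4 := (ih (n - m - 1) (by omega) (t + 1) (i - 1)).1 (l - 1)
          have e5 := (ih (n - m - 1) (by omega) (t + 1) (i - 2)).1 (l - 1)
          push_cast at *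
          rw [hrec n t i _ (by omega) (by omega) (by omega) hj,
            show (m - 1) * l - m + 1 = (m - 1) * (l - 1) by ring, e1, e2, e3, e4, e5,
            eFun_rec (n - l * m) t (i - l) l (by omega) (by omega)]
          rw [show n - 1 - l * m = n - l * m - 1 by ring,
            show n - m - 1 - (l - 1) * m = n - l * m - 1 by ring,
            show i - 1 - l = i - l - 1 by ring, show i - 1 - (l - 1) = i - l by ring,
            show i - 2 - (l - 1) = i - l - 1 by ring]
      · by_cases hb : n < 0 ∨ i < 0 ∨ j < 0
        · exact hneg _ _ _ _ (by omega)
        · have hj' : ¬ (m - 1) ∣ j - m + 1 := by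
            intro h
            apply hj
            have := dvd_add h (dvd_refl (m - 1))
            rwa [show j - m + 1 + (m - 1) = j by ring] at this
          have e1 := (iht i).2 j hj
          have e2 := (ih (n - 1) (by omega) (t + 1) i).2 j hj
          have e3 := (ih (n - 1) (by omega) t (i - 1)).2 j hj
          have e4 := (ih (n - m - 1) (by omega) (t + 1) (i - 1)).2 _ hj'
          have e5 := (ih (n - m - 1) (by omega) (t + 1) (i - 2)).2 _ hj'
          push_cast at *
          rw [hrec n t i _ (by omega) (by omega) (by omega) (by omega), e1, e2, e3, e4, e5]
          rfl

/-- Let `m ≥ 2` and let `c : ℤ⁴ → ℤ` vanish whenever an argument is negative,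
satisfy `c(n,0,i,j) = 1` if `n ≥ 0, i = j = 0` and `= 0` otherwise, and the
recursion `c(n,t+1,i,j) = c(n,t,i,j) + c(n-1,t+1,i,j) + c(n-1,t,i-1,j)
+ c(n-m-1,t+1,i-1,j-m+1) + c(n-m-1,t+1,i-2,j-m+1)` for `n,t,i,j ≥ 0`.
Then for all `n, i, j ≥ 0` and `t ≥ 1`: `c(n,t,i,j) = 0` unless
`j = (m-1)ℓ` for some integer `0 ≤ ℓ ≤ i`, and for every integer `ℓ ≥ 0`
one has `c(n,t,i,(m-1)ℓ) = d(n,t,i,ℓ)`. -/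
theorem stmt_9 (m : ℤ) (hm : 2 ≤ m) (c : ℤ → ℤ → ℤ → ℤ → ℤ)
    (hneg : ∀ n t i j : ℤ, n < 0 ∨ t < 0 ∨ i < 0 ∨ j < 0 → c n t i j = 0)
    (hzero : ∀ n i j : ℤ,
      c n 0 i j = if 0 ≤ n ∧ i = 0 ∧ j = 0 then 1 else 0)
    (hrec : ∀ n t i j : ℤ, 0 ≤ n → 0 ≤ t → 0 ≤ i → 0 ≤ j →
      c n (t + 1) i j =
        c n t i j + c (n - 1) (t + 1) i j + c (n - 1) t (i - 1) j
          + c (n - m - 1) (t + 1) (i - 1) (j - m + 1)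
          + c (n - m - 1) (t + 1) (i - 2) (j - m + 1)) :
    ∀ n t i j : ℤ, 0 ≤ n → 1 ≤ t → 0 ≤ i → 0 ≤ j →
      ((¬ ∃ l : ℤ, 0 ≤ l ∧ l ≤ i ∧ j = (m - 1) * l) → c n t i j = 0) ∧
      (∀ l : ℤ, 0 ≤ l → c n t i ((m - 1) * l) = dFun m n t i l) := by
  intro n t i j hn ht hi hj
  have hk := key m hm c hneg hzero hrec (n.toNat + 1) n (by push_cast; omega) t.toNat i
  rw [Int.toNat_of_nonneg (by omega)] at hk
  obtain ⟨h1, h2⟩ := hk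
  refine ⟨fun h => ?_, fun l hl => ?_⟩
  · by_cases hd : (m - 1) ∣ j
    · obtain ⟨l, rfl⟩ := hd
      have hl : ¬ (0 ≤ l ∧ l ≤ i) := fun h' => h ⟨l, h'.1, h'.2, rfl⟩
      rw [h1 l, eFun_zero _ _ _ _ (by omega)]
    · exact h2 j hd
  · rw [h1 l]
    unfold eFun dFun aFac
    rw [show n - l * m + t - (i - l) = n + t - l * m - i + l by ring,
      show t - (i - l) + l = t - i + 2 * l by ring]
    congr 2
    split_ifs with h0
    · subst h0; rw [ic_right0 _ (by omega)]
    · rfl
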